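/- arXiv:2501.05056 — 2 statements merged into one kernel-verified Lean document; each statement's English description precedes it below -/
import Mathlib

section
/- Let M ∈ ℝ and let N and δ be positive real numbers. Then there exists a smooth function ψ : ℝ → ℝ such that: ψ is non-negative; ψ(t) ≥ 1 for all t ∈ [M, M+N]; the Fourier transform ψ̂ satisfies ψ̂(0) = ∫_ℝ ψ(t) dt = N + δ^{-1}; ψ̂(α) = 0 whenever |α| > δ; and there exists a constant C (depending on M, N, δ) with ψ(t) ≤ C/(1 + t²) for all t ∈ ℝ. -/
open scoped FourierTransform
namespace BS
open Real MeasureTheory Set Filter Topology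

/-- `sin (π x) / (π x)`. -/
noncomputable def S (x : ℝ) : ℝ := Real.sinc (π * x)
/-- Fejer kernel. -/
noncomputable def K (x : ℝ) : ℝ := S x ^ 2
/-- Half-line sum of Fejer kernels. -/
noncomputable def W (x : ℝ) : ℝ := ∑' n : ℕ, K (x + (n + 1))
/-- Beurling majorant of the Heaviside function. -/
noncomputable def A (x : ℝ) : ℝ := 1 + x * K x - W x

lemma S_cont : Continuous S := Real.continuous_sinc.comp (by fun_prop)
lemma K_cont : Continuous K := S_cont.pow 2
lemma S_neg (x : ℝ) : S (-x) = S x := by simp [S, Real.sinc_neg]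
lemma K_neg (x : ℝ) : K (-x) = K x := by simp [K, S_neg]
lemma K_nonneg (x : ℝ) : 0 ≤ K x := sq_nonneg _
lemma S_zero : S 0 = 1 := by simp [S]
lemma S_of_ne {x : ℝ} (hx : x ≠ 0) : S x = sin (π * x) / (π * x) :=
  Real.sinc_of_ne_zero (mul_ne_zero pi_ne_zero hx)
lemma abs_S_le (x : ℝ) : |S x| ≤ 1 := Real.abs_sinc_le_one _

lemma K_of_ne {x : ℝ} (hx : x ≠ 0) : K x = sin (π * x) ^ 2 / π ^ 2 / x ^ 2 := by
  rw [K, S_of_ne hx]; field_simp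

lemma K_le_one (x : ℝ) : K x ≤ 1 := by
  rw [K]; exact (sq_le_one_iff_abs_le_one _).2 (abs_S_le x)

lemma K_le_inv {x : ℝ} (hx : x ≠ 0) : K x ≤ 1 / x ^ 2 := by
  rw [K_of_ne hx]
  have h1 : sin (π * x) ^ 2 ≤ 1 := Real.sin_sq_le_one _
  have h2 : 1 ≤ π ^ 2 := by nlinarith [Real.pi_gt_three]
  have : sin (π * x) ^ 2 / π ^ 2 ≤ 1 := by
    rw [div_le_one (by positivity)]; linarith
  gcongr

lemma K_le (x : ℝ) : K x ≤ 2 / (1 + x ^ 2) := by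
  rw [le_div_iff₀ (by positivity)]
  by_cases hx : x = 0
  · subst hx; simp [K, S_zero]
  · have h := K_le_inv hx
    rw [le_div_iff₀ (by positivity)] at h
    nlinarith [K_le_one x]

lemma K_int : Integrable K := by
  refine (integrable_inv_one_add_sq.const_mul 2).mono' K_cont.aestronglyMeasurable ?_
  refine ae_of_all _ fun x => ?_
  rw [Real.norm_of_nonneg (K_nonneg x), ← div_eq_mul_inv]
  exact K_le x

lemma box_int (x : ℝ) :
    ∫ u in (-1/2 : ℝ)..(1/2), Complex.exp (2 * π * Complex.I * x * u) = (S x : ℂ) := by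
  by_cases hx : x = 0
  · subst hx; simp [S_zero]; norm_num
  · have hc : (2 * π * Complex.I * x : ℂ) ≠ 0 := by
      simp [hx, Real.pi_ne_zero]
    rw [integral_exp_mul_complex hc, S_of_ne hx]
    push_cast
    rw [Complex.sin]
    have e1 : (2 * π * Complex.I * x * (1/2) : ℂ) = π * x * Complex.I := by ring
    have e2 : (2 * π * Complex.I * x * (-1/2) : ℂ) = -(π * x) * Complex.I := by ring
    rw [e1, e2]
    have hp : (π : ℂ) ≠ 0 := by exact_mod_cast Real.pi_ne_zero
    have hx' : (x : ℂ) ≠ 0 := by exact_mod_cast hx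
    field_simp
    rw [Complex.I_sq]; ring

lemma hasSum_K (x : ℝ) : HasSum (fun n : ℤ => K (x + n)) 1 := by
  have hab : (-1/2 : ℝ) < 1/2 := by norm_num
  have hc : Continuous (fun u : ℝ => Complex.exp (2 * π * Complex.I * (-x) * u)) := by fun_prop
  have hn : ∀ u : ℝ, ‖Complex.exp (2 * π * Complex.I * (-x) * u)‖ = 1 := by
    intro u
    rw [show (2 * π * Complex.I * (-x) * u : ℂ) = ((2 * π * (-x) * u : ℝ) : ℂ) * Complex.I by
      push_cast; ring]
    exact Complex.norm_exp_ofReal_mul_I _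
  have hL : MemLp (fun u : ℝ => Complex.exp (2 * π * Complex.I * (-x) * u)) 2
      (volume.restrict (Ioc (-1/2 : ℝ) (1/2))) := by
    refine MemLp.of_bound hc.aestronglyMeasurable 1 (ae_of_all _ fun u => (hn u).le)
  have h := hasSum_sq_fourierCoeffOn hab hL
  simp only [hn] at h
  convert h using 1
  · ext n
    rw [fourierCoeffOn_eq_integral]
    have : (∫ u in (-1/2 : ℝ)..(1/2), fourier (-n) (u : AddCircle ((1/2 : ℝ) - (-1/2))) •
        Complex.exp (2 * π * Complex.I * (-x) * u)) = (S (-(x + n)) : ℂ) := by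
      rw [← box_int]
      congr 1
      ext u
      rw [fourier_coe_apply, smul_eq_mul, ← Complex.exp_add]
      congr 1
      push_cast
      ring
    rw [this, S_neg]
    norm_num [K]
  · norm_num

lemma W_summable (x : ℝ) : Summable (fun n : ℕ => K (x + (n + 1))) := by
  have h := (hasSum_K x).summable.comp_injective
    (i := fun n : ℕ => (n : ℤ) + 1) (fun a b h => by simpa using h)
  refine h.congr fun n => ?_
  simp

lemma W_add (x : ℝ) : W x + K x + W (-x) = 1 := by
  have h1 := (W_summable x).hasSum
  have h2 := (W_summable (-x)).hasSum
  have h := HasSum.of_add_one_of_neg_add_one (f := fun n : ℤ => K (x + n)) (m := W x) (m' := W (-x))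
    (by simpa [W] using h1) (by
      rw [W]
      convert h2 using 1
      ext n
      rw [← K_neg]; congr 1; push_cast; ring)
  simpa using h.unique (hasSum_K x)

lemma W_sub (x : ℝ) : W (x - 1) = K x + W x := by
  rw [W, (W_summable (x-1)).tsum_eq_zero_add, W]
  congr 1
  · simp
  · congr 1; ext n; congr 1; push_cast; ring

lemma W_contOn : ContinuousOn W (Ici 0) := by
  have hs : Summable (fun n : ℕ => 1 / ((n : ℝ) + 1) ^ 2) := by
    have := (summable_nat_add_iff 1).2 (Real.summable_one_div_nat_pow.2 (one_lt_two))
    simpa using this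
  refine continuousOn_tsum (fun n => (K_cont.comp (by fun_prop)).continuousOn) hs ?_
  intro n x hx
  have hx : 0 ≤ x := hx
  rw [Real.norm_of_nonneg (K_nonneg _)]
  refine (K_le_inv (by positivity)).trans ?_
  exact one_div_le_one_div_of_le (by positivity) (pow_le_pow_left₀ (by positivity) (by linarith) 2)

lemma W_cont : Continuous W := by
  have h2 : ContinuousOn W (Iic 0) := by
    have : ContinuousOn (fun x => 1 - K x - W (-x)) (Iic 0) := by
      refine ContinuousOn.sub (by have := K_cont; fun_prop) ?_
      exact W_contOn.comp continuousOn_neg (fun x hx => by simpa using hx)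
    refine this.congr fun x _ => ?_
    linarith [W_add x]
  have h := W_contOn.union_of_isClosed h2 isClosed_Ici isClosed_Iic
  rw [show (Ici 0 ∪ Iic 0 : Set ℝ) = univ by
    ext x; simp] at h
  exact continuousOn_univ.1 h

lemma A_cont : Continuous A := by
  have := W_cont
  have := K_cont
  unfold A; fun_prop

lemma A_add_neg (x : ℝ) : A x + A (-x) = 1 + K x := by
  have := W_add x
  simp only [A, K_neg]; linarith

lemma tele {x : ℝ} (hx : 0 < x) :
    HasSum (fun n : ℕ => 1 / (x + n) - 1 / (x + (n + 1))) (1 / x) := by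
  rw [hasSum_iff_tendsto_nat_of_nonneg]
  · have h : ∀ n : ℕ, ∑ i ∈ Finset.range n, (1 / (x + i) - 1 / (x + (i + 1)))
        = 1 / x - 1 / (x + n) := by
      intro n
      have := Finset.sum_range_sub' (fun i : ℕ => 1 / (x + i)) n
      simpa using this
    simp only [h]
    have : Tendsto (fun n : ℕ => 1 / (x + n)) atTop (𝓝 0) := by
      have : Tendsto (fun n : ℕ => x + (n : ℝ)) atTop atTop :=
        tendsto_atTop_add_const_left _ _ tendsto_natCast_atTop_atTop
      simp only [one_div]
      exact tendsto_inv_atTop_zero.comp this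
    simpa using this.const_sub (1 / x)
  · intro n
    rw [sub_nonneg]
    gcongr; linarith

lemma K_shift {x : ℝ} (n : ℕ) (hx : x + n ≠ 0) :
    K (x + n) = sin (π * x) ^ 2 / π ^ 2 * (1 / (x + n) ^ 2) := by
  rw [K_of_ne hx]
  have : sin (π * (x + n)) ^ 2 = sin (π * x) ^ 2 := by
    rw [show π * (x + n) = π * x + n * π by ring, Real.sin_add_nat_mul_pi, mul_pow]
    rw [← pow_mul, mul_comm n 2, pow_mul]; simp
  rw [this]; ring

lemma W_bounds_pos {x : ℝ} (hx : 0 < x) : W x ≤ x * K x ∧ x * K x ≤ W x + K x := by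
  set s := sin (π * x) ^ 2 / π ^ 2 with hs
  have hs0 : 0 ≤ s := by positivity
  have hxK : x * K x = s * (1 / x) := by rw [K_of_ne hx.ne', ← hs]; field_simp
  have ht := (tele hx).mul_left s
  rw [hxK]
  constructor
  · refine hasSum_le ?_ (W_summable x).hasSum ht
    intro n
    have := K_shift (x := x) (n + 1) (by positivity)
    push_cast at this
    rw [this]
    refine mul_le_mul_of_nonneg_left ?_ hs0
    have h1 : 0 < x + n := by positivity
    have e : 1 / (x + n) - 1 / (x + (n + 1)) = 1 / ((x + n) * (x + (n + 1))) := by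
      field_simp; ring
    rw [e]
    have : (x + n) * (x + (n + 1)) ≤ (x + (n + 1)) ^ 2 := by nlinarith
    gcongr
  · have h2 : HasSum (fun n : ℕ => K (x + n)) (W x + K x) := by
      have := (W_summable (x - 1)).hasSum
      have e : (∑' n : ℕ, K (x - 1 + (n + 1))) = W x + K x := by
        have := W_sub x; rw [W] at this; linarith
      rw [e] at this
      convert this using 3
      ring
    refine hasSum_le ?_ ht h2
    intro n
    rw [K_shift (x := x) n (by positivity)]
    refine mul_le_mul_of_nonneg_left ?_ hs0
    have h1 : 0 < x + n := by positivity
    have e : 1 / (x + n) - 1 / (x + (n + 1)) = 1 / ((x + n) * (x + (n + 1))) := by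
      field_simp; ring
    rw [e]
    have : (x + n) ^ 2 ≤ (x + n) * (x + (n + 1)) := by nlinarith
    gcongr

lemma W_bounds {x : ℝ} (hx : 0 ≤ x) : W x ≤ x * K x ∧ x * K x ≤ W x + K x := by
  rcases hx.eq_or_lt with rfl | h
  · have h := W_add 0
    have : K 0 = 1 := by simp [K, S_zero]
    rw [neg_zero, this] at h
    rw [this]; constructor <;> linarith
  · exact W_bounds_pos h

/-- Difference of `A` and Heaviside. -/
noncomputable def g (x : ℝ) : ℝ := A x - (Ici (0:ℝ)).indicator 1 x

lemma g_bounds (x : ℝ) : 0 ≤ g x ∧ g x ≤ K x := by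
  rw [g]
  by_cases hx : 0 ≤ x
  · rw [indicator_of_mem (by exact hx)]
    have := W_bounds hx
    simp only [A, Pi.one_apply]
    constructor <;> linarith
  · rw [indicator_of_notMem (by exact hx)]
    have := W_bounds (x := -x) (by linarith)
    have h2 := W_add x
    rw [K_neg] at this
    simp only [A]
    constructor <;> linarith

lemma g_meas : Measurable g :=
  A_cont.measurable.sub (measurable_one.indicator measurableSet_Ici)

lemma g_int : Integrable g := by
  refine K_int.mono' g_meas.aestronglyMeasurable (ae_of_all _ fun x => ?_)
  rw [Real.norm_of_nonneg (g_bounds x).1]; exact (g_bounds x).2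

lemma K_integral : ∫ x, K x = 1 := by
  have h := K_int.hasSum_intervalIntegral_comp_add_int
  simp only [intervalIntegral.integral_of_le zero_le_one] at h
  have h2 := hasSum_integral_of_summable_integral_norm (μ := volume.restrict (Ioc (0:ℝ) 1))
    (F := fun (n : ℤ) x => K (x + n))
    (fun n => (K_int.comp_add_right (n : ℝ)).integrableOn)
    (by
      refine h.summable.congr fun n => ?_
      refine integral_congr_ae (ae_of_all _ fun x => ?_)
      exact (Real.norm_of_nonneg (K_nonneg _)).symm)
  rw [h.unique h2]
  simp only [(hasSum_K _).tsum_eq]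
  simp

lemma g_integral : ∫ x, g x = 1 / 2 := by
  have h1 : ∫ x, g (-x) = ∫ x, g x := integral_neg_eq_self g volume
  have h2 : ∫ x, (g x + g (-x)) = ∫ x, K x := by
    refine integral_congr_ae ?_
    have : ∀ᵐ x : ℝ, x ≠ 0 := by simp [ae_iff]
    filter_upwards [this] with x hx
    have := A_add_neg x
    simp only [g]
    rcases lt_or_gt_of_ne hx with h | h
    · rw [indicator_of_notMem (by simpa using h), indicator_of_mem (by simpa using h.le)]
      simp only [Pi.one_apply]; linarith
    · rw [indicator_of_mem (by simpa using h.le), indicator_of_notMem (by simpa using h)]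
      simp only [Pi.one_apply]; linarith
  rw [integral_add g_int g_int.comp_neg, h1, K_integral] at h2
  linarith

/-- The box function, modulated. -/
noncomputable def box (a : ℝ) : ℝ → ℂ :=
  (Ioc (-1/2 : ℝ) (1/2)).indicator fun u => Complex.exp (2 * π * Complex.I * a * u)

lemma box_integrable (a : ℝ) : Integrable (box a) := by
  have hc : Continuous fun u : ℝ => Complex.exp (2 * π * Complex.I * a * u) := by fun_prop
  exact (integrable_indicator_iff measurableSet_Ioc).2
    ((hc.integrableOn_Icc).mono_set Ioc_subset_Icc_self)

lemma fourier_box (a x : ℝ) : 𝓕 (box a) x = (S (x - a) : ℂ) := by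
  rw [Real.fourier_real_eq_integral_exp_smul, ← S_neg, ← box_int,
    intervalIntegral.integral_of_le (by norm_num), ← integral_indicator measurableSet_Ioc]
  congr 1
  ext u
  by_cases hu : u ∈ Ioc (-1/2 : ℝ) (1/2)
  · rw [box, indicator_of_mem hu, indicator_of_mem hu, smul_eq_mul, ← Complex.exp_add]
    congr 1
    push_cast
    ring
  · rw [box, indicator_of_notMem hu, indicator_of_notMem hu, smul_zero]

/-- Product of two shifted sinc functions. -/
noncomputable def P (a b x : ℝ) : ℝ := S (x - a) * S (x - b)

lemma P_cont (a b : ℝ) : Continuous (P a b) := by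
  have := S_cont
  unfold P; fun_prop

lemma P_int (a b : ℝ) : Integrable (P a b) := by
  refine ((K_int.comp_sub_right a).add (K_int.comp_sub_right b)).mono'
    (P_cont a b).aestronglyMeasurable (ae_of_all _ fun x => ?_)
  simp only [P, K, Pi.add_apply, Real.norm_eq_abs]
  rw [abs_le]
  constructor <;> nlinarith [sq_nonneg (S (x - a) + S (x - b)), sq_nonneg (S (x - a) - S (x - b))]

lemma fourier_P (a b : ℝ) {α : ℝ} (hα : 1 < |α|) :
    𝓕 (fun x : ℝ => (P a b x : ℂ)) α = 0 := by
  set c : ℝ → ℂ := MeasureTheory.convolution (box a) (box b) (ContinuousLinearMap.mul ℂ ℂ) volume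
    with hc
  have hci : Integrable c := (box_integrable a).integrable_convolution _ (box_integrable b)
  have hfc : 𝓕 c = fun x : ℝ => (P a b x : ℂ) := by
    ext x
    rw [hc, Real.fourier_mul_convolution_eq (box_integrable a) (box_integrable b), fourier_box,
      fourier_box, P]
    push_cast; rfl
  have hz : ∀ v : ℝ, 1 < |v| → c v = 0 := by
    intro v hv
    rw [hc, MeasureTheory.convolution]
    rw [← integral_zero ℝ ℂ]
    congr 1
    ext u
    by_cases hu : u ∈ Ioc (-1/2 : ℝ) (1/2)
    · have : v - u ∉ Ioc (-1/2 : ℝ) (1/2) := by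
        rintro ⟨h1, h2⟩
        obtain ⟨h3, h4⟩ := hu
        have : |v| ≤ 1 := abs_le.2 ⟨by linarith, by linarith⟩
        linarith
      rw [box, box, indicator_of_notMem this, map_zero]
    · rw [box, indicator_of_notMem hu, map_zero, zero_apply]
  have hopen : IsOpen {v : ℝ | 1 < |v|} := isOpen_lt continuous_const continuous_abs
  have hα' : 1 < |-α| := by rwa [abs_neg]
  have hca : ContinuousAt c (-α) := by
    have : c =ᶠ[𝓝 (-α)] fun _ => 0 := by
      filter_upwards [hopen.mem_nhds hα'] with v hv using hz v hv
    exact continuousAt_const.congr this.symm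
  have hfi : Integrable (𝓕 c) := by
    rw [hfc]; exact (P_int a b).ofReal
  have := hci.fourierInv_fourier_eq hfi hca
  rw [Real.fourierInv_eq_fourier_neg, neg_neg, hz _ hα', hfc] at this
  exact this

lemma cross (x : ℝ) : x * K x - (x - 1) * K (x - 1) = S x * S (x - 1) := by
  by_cases h0 : x = 0
  · subst h0
    have : S (0 - 1) = 0 := by rw [S_of_ne (by norm_num)]; simp
    rw [K, K, this]; ring
  by_cases h1 : x - 1 = 0
  · have hx : x = 1 := by linarith
    have : S 1 = 0 := by rw [S_of_ne (by norm_num)]; simp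
    rw [hx]
    simp [K, this]
  · rw [K, K, S_of_ne h0, S_of_ne h1]
    have : sin (π * (x - 1)) = - sin (π * x) := by
      rw [mul_sub, mul_one, Real.sin_sub_pi]
    rw [this]
    field_simp
    ring

lemma A_sub (x : ℝ) : A x - A (x - 1) = P 0 0 x + P 0 1 x := by
  have h1 := cross x
  have h2 := W_sub x
  simp only [A, P, sub_zero]
  have : K x = S x * S x := by rw [K, sq]
  linarith

/-- The majorant of `[0,L]` of type one. -/
noncomputable def Ψ (L x : ℝ) : ℝ := A x + A (L - x) - 1

lemma Ψ_cont (L : ℝ) : Continuous (Ψ L) := by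
  have := A_cont
  unfold Ψ; fun_prop

lemma Ψ_eq {L : ℝ} (hL : 0 < L) (x : ℝ) :
    Ψ L x = (Icc 0 L).indicator 1 x + (g x + g (L - x)) := by
  simp only [Ψ, g, indicator, mem_Ici, mem_Icc, Pi.one_apply, sub_nonneg]
  by_cases h1 : 0 ≤ x <;> by_cases h2 : x ≤ L
  · simp [h1, h2]; ring
  · simp [h1, h2]; ring
  · simp [h1, h2]; ring
  · exfalso; linarith

lemma Ψ_nonneg {L : ℝ} (hL : 0 < L) (x : ℝ) : 0 ≤ Ψ L x := by
  rw [Ψ_eq hL]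
  have h1 := (g_bounds x).1
  have h2 := (g_bounds (L - x)).1
  have : (0:ℝ) ≤ (Icc 0 L).indicator 1 x := indicator_nonneg (fun _ _ => zero_le_one) _
  linarith

lemma Ψ_ge {L : ℝ} (hL : 0 < L) {x : ℝ} (hx : x ∈ Icc 0 L) : 1 ≤ Ψ L x := by
  rw [Ψ_eq hL, indicator_of_mem hx]
  have h1 := (g_bounds x).1
  have h2 := (g_bounds (L - x)).1
  simp only [Pi.one_apply]
  linarith

lemma Ψ_bound {L : ℝ} (hL : 0 < L) : ∃ C : ℝ, 0 ≤ C ∧ ∀ x, Ψ L x ≤ C / (1 + x ^ 2) := by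
  refine ⟨(1 + L ^ 2) + 2 + 2 * (2 * (1 + L ^ 2)), by positivity, fun x => ?_⟩
  rw [Ψ_eq hL, add_assoc, add_div, add_div 2]
  refine add_le_add ?_ (add_le_add ((g_bounds x).2.trans (K_le x))
    (((g_bounds _).2.trans (K_le _)).trans ?_))
  · by_cases hx : x ∈ Icc 0 L
    · rw [indicator_of_mem hx, Pi.one_apply, le_div_iff₀ (by positivity)]
      have := pow_le_pow_left₀ hx.1 hx.2 2
      linarith
    · rw [indicator_of_notMem hx]; positivity
  · rw [div_le_div_iff₀ (by positivity) (by positivity)]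
    have : 1 + x ^ 2 ≤ 2 * (1 + L ^ 2) * (1 + (L - x) ^ 2) := by
      nlinarith [sq_nonneg (2 * L - x), sq_nonneg (L * (L - x))]
    nlinarith

lemma Ψ_hasIntegral {L : ℝ} (hL : 0 < L) : Integrable (Ψ L) ∧ ∫ x, Ψ L x = L + 1 := by
  have h1 : Integrable ((Icc 0 L).indicator (1 : ℝ → ℝ)) :=
    (integrable_indicator_iff measurableSet_Icc).2
      (integrableOn_const (by simp))
  have h2 : Integrable (fun x => g (L - x)) := g_int.comp_sub_left L
  have e : Ψ L = fun x => (Icc 0 L).indicator 1 x + (g x + g (L - x)) := funext (Ψ_eq hL)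
  have h3 : Integrable (fun x => g x + g (L - x)) := g_int.add h2
  rw [e]
  refine ⟨h1.add h3, ?_⟩
  rw [integral_add h1 h3, integral_add g_int h2, integral_sub_left_eq_self g volume L, g_integral,
    integral_indicator_one measurableSet_Icc]
  simp [hL.le]; norm_num

lemma Ψ_sub (L x : ℝ) : Ψ L x - Ψ L (x - 1)
    = (P 0 0 x + P 0 1 x) - (P (L+1) (L+1) x + P (L+1) L x) := by
  have h1 := A_sub x
  have h2 := A_sub (L + 1 - x)
  have e1 : P 0 0 (L + 1 - x) = P (L+1) (L+1) x := by
    simp only [P, sub_zero]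
    rw [← S_neg (x - (L + 1)), neg_sub]
  have e2 : P 0 1 (L + 1 - x) = P (L+1) L x := by
    simp only [P, sub_zero]
    rw [← S_neg (x - (L + 1)), neg_sub, ← S_neg (x - L), neg_sub]; congr 2; ring
  rw [e1, e2] at h2
  rw [← h1, ← h2, Ψ, Ψ, show L + 1 - x - 1 = L - x by ring, show L - (x - 1) = L + 1 - x by ring]
  ring

lemma fourier_shift (f : ℝ → ℂ) (α : ℝ) :
    𝓕 (fun x => f (x - 1)) α = Complex.exp (-(2 * π * Complex.I * α)) * 𝓕 f α := by
  rw [Real.fourier_real_eq_integral_exp_smul, Real.fourier_real_eq_integral_exp_smul,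
    ← integral_const_mul, ← integral_sub_right_eq_self (fun x : ℝ =>
      Complex.exp (-(2 * π * Complex.I * α)) *
        Complex.exp (((-2 * π * x * α : ℝ) : ℂ) * Complex.I) • f x) (1 : ℝ)]
  congr 1
  ext x
  simp only [smul_eq_mul]
  rw [← mul_assoc, ← Complex.exp_add]
  congr 2
  push_cast; ring

lemma fourier_add' {f h : ℝ → ℂ} (hf : Integrable f) (hh : Integrable h) (α : ℝ) :
    𝓕 (fun x => f x + h x) α = 𝓕 f α + 𝓕 h α := by
  simp only [Real.fourier_real_eq]
  rw [← integral_add]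
  · simp only [smul_add]
  · exact (Real.fourierIntegral_convergent_iff (V := ℝ) α).2 hf |>.congr (by simp [mul_comm])
  · exact (Real.fourierIntegral_convergent_iff (V := ℝ) α).2 hh |>.congr (by simp [mul_comm])

lemma fourier_sub' {f h : ℝ → ℂ} (hf : Integrable f) (hh : Integrable h) (α : ℝ) :
    𝓕 (fun x => f x - h x) α = 𝓕 f α - 𝓕 h α := by
  have := fourier_add' (hf.sub hh) hh α
  simp only [Pi.sub_apply, sub_add_cancel] at this
  rw [this]; exact (add_sub_cancel_right _ _).symm

lemma fourier_cont {f : ℝ → ℂ} (hf : Integrable f) : Continuous (𝓕 f) :=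
  VectorFourier.fourierIntegral_continuous Real.continuous_fourierChar
    (innerSL ℝ).continuous₂ hf

lemma fourier_Ψ {L : ℝ} (hL : 0 < L) {α : ℝ} (hα : 1 < |α|) :
    𝓕 (fun x : ℝ => (Ψ L x : ℂ)) α = 0 := by
  have hi : Integrable (fun x : ℝ => (Ψ L x : ℂ)) := (Ψ_hasIntegral hL).1.ofReal
  have key : ∀ β : ℝ, 1 < |β| → Irrational β → 𝓕 (fun x : ℝ => (Ψ L x : ℂ)) β = 0 := by
    intro β hβ hir
    have h1 := fourier_sub' hi (hi.comp_sub_right 1) β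
    rw [fourier_shift (fun x : ℝ => (Ψ L x : ℂ))] at h1
    have e : (fun x : ℝ => (Ψ L x : ℂ) - (Ψ L (x - 1) : ℂ)) = fun x : ℝ =>
        ((P 0 0 x : ℂ) + (P 0 1 x : ℂ)) - ((P (L+1) (L+1) x : ℂ) + (P (L+1) L x : ℂ)) := by
      ext x
      exact_mod_cast congrArg (fun r : ℝ => (r : ℂ)) (Ψ_sub L x)
    have hP : ∀ a b, Integrable (fun x : ℝ => (P a b x : ℂ)) := fun a b => (P_int a b).ofReal
    have hPP : ∀ a b c d, Integrable (fun x : ℝ => (P a b x : ℂ) + (P c d x : ℂ)) :=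
      fun a b c d => (hP a b).add (hP c d)
    rw [e, fourier_sub' (hPP _ _ _ _) (hPP _ _ _ _),
      fourier_add' (hP _ _) (hP _ _), fourier_add' (hP _ _) (hP _ _), fourier_P _ _ hβ,
      fourier_P _ _ hβ, fourier_P _ _ hβ, fourier_P _ _ hβ] at h1
    have h2 : (1 - Complex.exp (-(2 * π * Complex.I * β))) *
        𝓕 (fun x : ℝ => (Ψ L x : ℂ)) β = 0 := by
      rw [sub_mul, one_mul, ← h1]; ring
    rcases mul_eq_zero.1 h2 with h | h
    · exfalso
      have h3 : Complex.exp (-(2 * π * Complex.I * β)) = 1 := by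
        linear_combination -h
      obtain ⟨n, hn⟩ := Complex.exp_eq_one_iff.1 h3
      have hc : (2 * π * Complex.I : ℂ) ≠ 0 := Complex.two_pi_I_ne_zero
      have : (β : ℂ) = ((-n : ℤ) : ℂ) := by
        apply mul_left_cancel₀ hc
        push_cast
        linear_combination -hn
      have : β = ((-n : ℤ) : ℝ) := by exact_mod_cast this
      exact (this ▸ hir).ne_int _ rfl
    · exact h
  have hopen : IsOpen {v : ℝ | 1 < |v|} := isOpen_lt continuous_const continuous_abs
  have hcl := dense_irrational.open_subset_closure_inter hopen hα
  have hclosed : IsClosed {β : ℝ | 𝓕 (fun x : ℝ => (Ψ L x : ℂ)) β = 0} :=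
    isClosed_eq (fourier_cont hi) continuous_const
  exact closure_minimal (fun β hβ => key β hβ.1 hβ.2) hclosed hcl

lemma Ψ_smooth {L : ℝ} (hL : 0 < L) : ContDiff ℝ (⊤ : ℕ∞) (Ψ L) := by
  set f : ℝ → ℂ := fun x : ℝ => (Ψ L x : ℂ) with hf
  have hi : Integrable f := (Ψ_hasIntegral hL).1.ofReal
  have hc : Continuous f := Complex.continuous_ofReal.comp (Ψ_cont L)
  have hcF : Continuous (𝓕 f) := fourier_cont hi
  have hsupp : HasCompactSupport (𝓕 f) := by
    refine HasCompactSupport.of_support_subset_isCompact (isCompact_Icc (a := (-1:ℝ)) (b := 1)) ?_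
    intro α hα
    by_contra h
    refine hα (fourier_Ψ hL ?_)
    by_contra h2
    exact h (abs_le.1 (not_lt.1 h2))
  have hFi : Integrable (𝓕 f) := hcF.integrable_of_hasCompactSupport hsupp
  have hinv := hc.fourierInv_fourier_eq hi hFi
  have hsm : ContDiff ℝ (⊤ : ℕ∞) (𝓕 (𝓕 f)) := by
    refine Real.contDiff_fourier fun n _ => ?_
    refine Continuous.integrable_of_hasCompactSupport (by fun_prop) ?_
    exact hsupp.norm.mul_left
  have e : Ψ L = fun x => Complex.reCLM (𝓕 (𝓕 f) (-x)) := by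
    ext x
    rw [← Real.fourierInv_eq_fourier_neg, hinv]
    simp [hf]
  rw [e]
  exact Complex.reCLM.contDiff.comp (hsm.comp contDiff_neg)

end BS

/-- Lemma 3.1 (Beurling–Selberg majorant): there is a smooth non-negative majorant of the
indicator function of `[M, M+N]` whose Fourier transform is supported in `[-δ, δ]`, with
total mass `N + δ⁻¹` and quadratic decay. -/
theorem beurling_selberg_majorant (M N δ : ℝ) (hN : 0 < N) (hδ : 0 < δ) :
    ∃ ψ : ℝ → ℝ,
      ContDiff ℝ (⊤ : ℕ∞) ψ ∧
      (∀ t : ℝ, 0 ≤ ψ t) ∧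
      (∀ t ∈ Set.Icc M (M + N), 1 ≤ ψ t) ∧
      𝓕 (fun t : ℝ => (ψ t : ℂ)) 0 = ((N + δ⁻¹ : ℝ) : ℂ) ∧
      (∫ t : ℝ, ψ t) = N + δ⁻¹ ∧
      (∀ α : ℝ, δ < |α| → 𝓕 (fun t : ℝ => (ψ t : ℂ)) α = 0) ∧
      ∃ C : ℝ, ∀ t : ℝ, ψ t ≤ C / (1 + t ^ 2) := by
  have hL : 0 < N * δ := mul_pos hN hδ
  have hTotal : (∫ t : ℝ, BS.Ψ (N * δ) (δ * (t - M))) = N + δ⁻¹ := by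
    rw [MeasureTheory.integral_sub_right_eq_self (fun t => BS.Ψ (N * δ) (δ * t)) M,
      MeasureTheory.Measure.integral_comp_mul_left, (BS.Ψ_hasIntegral hL).2,
      abs_of_pos (inv_pos.2 hδ), smul_eq_mul]
    field_simp
  refine ⟨fun t => BS.Ψ (N * δ) (δ * (t - M)), ?_, fun t => BS.Ψ_nonneg hL _, ?_, ?_, hTotal, ?_, ?_⟩
  · exact (BS.Ψ_smooth hL).comp (by fun_prop)
  · intro t ht
    refine BS.Ψ_ge hL ⟨mul_nonneg hδ.le (by linarith [ht.1]), ?_⟩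
    rw [mul_comm]
    exact mul_le_mul_of_nonneg_right (by linarith [ht.2]) hδ.le
  · rw [Real.fourier_real_eq_integral_exp_smul, ← hTotal, ← integral_complex_ofReal]
    simp
  · intro α hα
    have h := BS.fourier_Ψ hL (α := α / δ) (by
      rw [abs_div, abs_of_pos hδ, lt_div_iff₀ hδ]; linarith)
    rw [Real.fourier_real_eq_integral_exp_smul] at h ⊢
    have e : ∀ t : ℝ, Complex.exp (((-2 * Real.pi * t * α : ℝ) : ℂ) * Complex.I) •
        ((BS.Ψ (N * δ) (δ * (t - M)) : ℝ) : ℂ) =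
        (fun s : ℝ => Complex.exp (((-2 * Real.pi * M * α : ℝ) : ℂ) * Complex.I) *
          (fun x : ℝ => Complex.exp (((-2 * Real.pi * x * (α / δ) : ℝ) : ℂ) * Complex.I) •
          ((BS.Ψ (N * δ) x : ℝ) : ℂ)) (δ * s)) (t - M) := by
      intro t
      simp only [smul_eq_mul]
      rw [← mul_assoc, ← Complex.exp_add]
      congr 2
      have hd : (δ : ℂ) ≠ 0 := by exact_mod_cast hδ.ne'
      push_cast
      field_simp
      ring
    rw [MeasureTheory.integral_congr_ae (MeasureTheory.ae_of_all _ e)]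
    refine (MeasureTheory.integral_sub_right_eq_self (fun s : ℝ =>
      Complex.exp (((-2 * Real.pi * M * α : ℝ) : ℂ) * Complex.I) *
          (fun x : ℝ => Complex.exp (((-2 * Real.pi * x * (α / δ) : ℝ) : ℂ) * Complex.I) •
          ((BS.Ψ (N * δ) x : ℝ) : ℂ)) (δ * s)) M).trans ?_
    rw [MeasureTheory.integral_const_mul]
    have h' := MeasureTheory.Measure.integral_comp_mul_left (fun x : ℝ =>
      Complex.exp (((-2 * Real.pi * x * (α / δ) : ℝ) : ℂ) * Complex.I) •
          ((BS.Ψ (N * δ) x : ℝ) : ℂ)) δ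
    refine mul_eq_zero_of_right _ (h'.trans ?_)
    rw [h, smul_zero]
  · obtain ⟨C, hC, hb⟩ := BS.Ψ_bound hL
    refine ⟨C * (2 * (1 + M ^ 2) * (1 + δ⁻¹ ^ 2)), fun t => (hb _).trans ?_⟩
    rw [div_le_div_iff₀ (by positivity) (by positivity), mul_assoc]
    refine mul_le_mul_of_nonneg_left ?_ hC
    have h1 : 1 + t ^ 2 ≤ 2 * (1 + M ^ 2) * (1 + (t - M) ^ 2) := by
      nlinarith [sq_nonneg (t - 2 * M), sq_nonneg (M * (t - M))]
    have h2 : 1 + (t - M) ^ 2 ≤ (1 + δ⁻¹ ^ 2) * (1 + (δ * (t - M)) ^ 2) := by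
      have : (δ⁻¹) ^ 2 * (δ * (t - M)) ^ 2 = (t - M) ^ 2 := by field_simp
      nlinarith [sq_nonneg (δ⁻¹), sq_nonneg (δ * (t - M))]
    calc 1 + t ^ 2 ≤ 2 * (1 + M ^ 2) * (1 + (t - M) ^ 2) := h1
      _ ≤ 2 * (1 + M ^ 2) * ((1 + δ⁻¹ ^ 2) * (1 + (δ * (t - M)) ^ 2)) := by gcongr
      _ = _ := by ring
end

section
/- For every real number p ≥ 1, one has ∫₀^∞ p e^{−t²/4} t^{p−1} dt = 2^p Γ(1 + p/2), and moreover 2^p Γ(1 + p/2) ≤ ((9/5)√p)^p. -/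
lemma aux_base (x : ℝ) (h1 : 1 / 2 ≤ x) (h2 : x ≤ 3 / 2) :
    Real.log (Real.Gamma (1 + x)) ≤ x * Real.log (81 / 50 * x) := by
  have hc := Real.convexOn_log_Gamma.2
    (show (3 / 2 : ℝ) ∈ Set.Ioi 0 by norm_num) (show (5 / 2 : ℝ) ∈ Set.Ioi 0 by norm_num)
    (show 0 ≤ 3 / 2 - x by linarith) (show 0 ≤ x - 1 / 2 by linarith) (by ring)
  simp only [smul_eq_mul, Function.comp] at hc
  have e : (3 / 2 - x) * (3 / 2) + (x - 1 / 2) * (5 / 2) = 1 + x := by ring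
  rw [e] at hc
  have g3 : Real.Gamma (3 / 2) = 1 / 2 * Real.sqrt Real.pi := by
    rw [show (3 / 2 : ℝ) = 1 / 2 + 1 by norm_num, Real.Gamma_add_one (by norm_num),
      Real.Gamma_one_half_eq]
  have hpos : 0 < Real.Gamma (3 / 2) := Real.Gamma_pos_of_pos (by norm_num)
  have g5 : Real.log (Real.Gamma (5 / 2)) =
      Real.log (3 / 2) + Real.log (Real.Gamma (3 / 2)) := by
    rw [show (5 / 2 : ℝ) = 3 / 2 + 1 by norm_num, Real.Gamma_add_one (by norm_num),
      Real.log_mul (by norm_num) hpos.ne']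
  have hg : Real.log (Real.Gamma (3 / 2)) ≤ 1 / 2 * Real.log (81 / 100) := by
    have : Real.Gamma (3 / 2) ≤ 9 / 10 := by
      rw [g3]
      have : Real.sqrt Real.pi ≤ 9 / 5 := by
        rw [Real.sqrt_le_left (by norm_num)]
        linarith [Real.pi_lt_d2]
      linarith
    have h := Real.log_le_log hpos this
    rw [show (81 / 100 : ℝ) = (9 / 10) ^ 2 by norm_num, Real.log_pow]
    push_cast
    linarith
  rw [g5] at hc
  have hx : 0 < x := by linarith
  have hl : Real.log (81 / 50 * x) = Real.log (81 / 100) + Real.log (2 * x) := by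
    rw [← Real.log_mul (by norm_num) (by positivity)]
    congr 1
    ring
  have ht : x - 1 / 2 ≤ x * Real.log (2 * x) := by
    have h := Real.one_sub_inv_le_log_of_pos (x := 2 * x) (by positivity)
    have := mul_le_mul_of_nonneg_left h hx.le
    have e : x * (1 - (2 * x)⁻¹) = x - 1 / 2 := by field_simp
    linarith
  have hd : Real.log (3 / 2) - Real.log (81 / 100) ≤ 1 := by
    rw [← Real.log_div (by norm_num) (by norm_num)]
    have := Real.log_le_sub_one_of_pos (x := (3 / 2) / (81 / 100)) (by norm_num)
    norm_num at this ⊢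
    linarith
  rw [hl]
  nlinarith [mul_le_mul_of_nonneg_left hd (by linarith : 0 ≤ x - 1 / 2)]

lemma aux_all (n : ℕ) : ∀ x : ℝ, 1 / 2 ≤ x → x ≤ n + 3 / 2 →
    Real.log (Real.Gamma (1 + x)) ≤ x * Real.log (81 / 50 * x) := by
  induction n with
  | zero => intro x h1 h2; exact aux_base x h1 (by simpa using h2)
  | succ n ih =>
    intro x h1 h2
    by_cases h : x ≤ 3 / 2
    · exact aux_base x h1 h
    push Not at h
    push_cast at h2
    have hi := ih (x - 1) (by linarith) (by linarith)
    rw [show 1 + (x - 1) = x by ring] at hi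
    have hx : 0 < x := by linarith
    rw [add_comm, Real.Gamma_add_one hx.ne',
      Real.log_mul hx.ne' (Real.Gamma_pos_of_pos hx).ne']
    have a1 : Real.log (81 / 50 * (x - 1)) ≤ Real.log (81 / 50 * x) :=
      Real.log_le_log (by linarith) (by linarith)
    have a2 : Real.log x ≤ Real.log (81 / 50 * x) :=
      Real.log_le_log (by linarith) (by linarith)
    nlinarith [mul_le_mul_of_nonneg_left a1 (by linarith : 0 ≤ x - 1)]

/-- The evaluation `∫₀^∞ p e^{−t²/4} t^{p−1} dt = 2^p Γ(1 + p/2)` together with the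
bound `2^p Γ(1 + p/2) ≤ ((9/5)√p)^p`, for every real `p ≥ 1`. -/
theorem integral_eval_and_gamma_bound (p : ℝ) (hp : 1 ≤ p) :
    (∫ t in Set.Ioi (0 : ℝ), p * Real.exp (-t ^ 2 / 4) * t ^ (p - 1))
        = 2 ^ p * Real.Gamma (1 + p / 2) ∧
      (2 : ℝ) ^ p * Real.Gamma (1 + p / 2) ≤ ((9 / 5) * Real.sqrt p) ^ p := by
  have hp0 : 0 < p := by linarith
  constructor
  · have h := integral_rpow_mul_exp_neg_mul_rpow (p := 2) (q := p - 1) (b := 1 / 4)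
      (by norm_num) (by linarith) (by norm_num)
    have e : ∀ t : ℝ, p * Real.exp (-t ^ 2 / 4) * t ^ (p - 1) =
        p * (t ^ (p - 1) * Real.exp (-(1 / 4) * t ^ (2 : ℝ))) := by
      intro t
      rw [Real.rpow_two, show -t ^ 2 / 4 = -(1 / 4) * t ^ 2 by ring]
      ring
    simp_rw [e]
    rw [MeasureTheory.integral_const_mul, h, add_comm 1 (p / 2),
      Real.Gamma_add_one (by positivity), show (p - 1 + 1) / 2 = p / 2 by ring]
    have e2 : (1 / 4 : ℝ) ^ (-(p - 1 + 1) / 2) = 2 ^ p := by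
      rw [show (1 / 4 : ℝ) = 2 ^ (-2 : ℝ) by
        rw [Real.rpow_neg (by norm_num), Real.rpow_two]; norm_num,
        ← Real.rpow_mul (by norm_num)]
      congr 1
      ring
    rw [e2]
    ring
  · obtain ⟨n, hn⟩ := exists_nat_ge (p / 2)
    have h := aux_all n (p / 2) (by linarith) (by linarith)
    have hG : 0 < Real.Gamma (1 + p / 2) := Real.Gamma_pos_of_pos (by positivity)
    have hs : 0 < Real.sqrt p := Real.sqrt_pos.2 hp0
    rw [← Real.log_le_log_iff (by positivity) (by positivity),
      Real.log_mul (by positivity) hG.ne', Real.log_rpow (by norm_num),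
      Real.log_rpow (by positivity)]
    have e : Real.log (81 / 50 * (p / 2)) =
        2 * Real.log (9 / 5 * Real.sqrt p) - 2 * Real.log 2 := by
      have e1 : 81 / 50 * (p / 2) = (9 / 5 * Real.sqrt p) ^ 2 / 2 ^ 2 := by
        rw [mul_pow, Real.sq_sqrt hp0.le]
        ring
      rw [e1, Real.log_div (by positivity) (by positivity), Real.log_pow, Real.log_pow]
      push_cast
      ring
    rw [e] at h
    linarith
end
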